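/- There exists a positive constant C such that for all N ≥ 1 and all i ∈ Λ^N, the variance under the invariant measure satisfies |σ^N(i,i) − (w^N(i))²/2| ≤ C N³, where w^N(i) = i(N+1−i). -/

import Mathlib

open MeasureTheory ProbabilityTheory Filter

noncomputable section

/-- The uniform distribution on `[0,1]`. -/
def unif01 : Measure ℝ := volume.restrict (Set.Icc (0:ℝ) 1)

/-- Truncation of a configuration to the box `Λ^N = {1,…,N}` (zero outside). -/
def trunc (N : ℕ) (w : ℤ → ℝ) : ℤ → ℝ :=
  fun i => if 1 ≤ i ∧ i ≤ (N : ℤ) then w i else 0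

/-- One step of the width-`N` silo dynamics with fractions `u` and added weights `v`. -/
def siloStep (N : ℕ) (u v w : ℤ → ℝ) : ℤ → ℝ :=
  trunc N fun i => v i + trunc N w (i + 1) * u (i + 1) + trunc N w (i - 1) * (1 - u (i - 1))

/-- `ν` is the product measure on `ℤ → ℝ` with all marginals `m`
(characterized through its finite-dimensional distributions). -/
def IsProductLaw (m : Measure ℝ) (ν : Measure (ℤ → ℝ)) : Prop :=
  IsProbabilityMeasure ν ∧
    ∀ I : Finset ℤ, ν.map (fun w (i : I) => w (i : ℤ)) = Measure.pi fun _ : I => m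

/-- The law on `ℤ → ℝ` which is iid `m` on the finite window `I` and `0` elsewhere. -/
def finExtLaw (I : Finset ℤ) (m : Measure ℝ) : Measure (ℤ → ℝ) :=
  (Measure.pi fun _ : I => m).map fun f i => if h : i ∈ I then f ⟨i, h⟩ else 0

/-- Law of the pair (fractions, weights) driving one step of the width-`N` silo. -/
def siloDriveLaw (N : ℕ) (νV : Measure ℝ) : Measure ((ℤ → ℝ) × (ℤ → ℝ)) :=
  (finExtLaw (Finset.Icc 0 ((N : ℤ) + 1)) unif01).prod (finExtLaw (Finset.Icc 1 (N : ℤ)) νV)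

/-- `μ` is carried by the state space `[0,∞)^{Λ^N}`. -/
def SiloSupported (N : ℕ) (μ : Measure (ℤ → ℝ)) : Prop :=
  μ {w | ∀ i : ℤ, 0 ≤ w i ∧ (¬(1 ≤ i ∧ i ≤ (N : ℤ)) → w i = 0)} = 1

/-- Hypotheses on the common law of the grain weights `V_t(i)`: a probability measure on
`[0,∞)` with mean `1` and finite variance. -/
def IsVLaw (νV : Measure ℝ) : Prop :=
  IsProbabilityMeasure νV ∧ νV {x | x < 0} = 0 ∧ (∫ x, x ∂νV) = 1 ∧
    Integrable (fun x => x ^ 2) νV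

/-- `μ` is an invariant probability measure for the width-`N` silo process. -/
def IsSiloInvariant (N : ℕ) (νV : Measure ℝ) (μ : Measure (ℤ → ℝ)) : Prop :=
  IsProbabilityMeasure μ ∧ SiloSupported N μ ∧
    (μ.prod (siloDriveLaw N νV)).map (fun p => siloStep N p.2.1 p.2.2 p.1) = μ

/-- The law of the silo process at time `t`, started from the distribution `μ0`. -/
def siloChainLaw (N : ℕ) (νV : Measure ℝ) (μ0 : Measure (ℤ → ℝ)) : ℕ → Measure (ℤ → ℝ)
  | 0 => μ0
  | t + 1 =>
      ((siloChainLaw N νV μ0 t).prod (siloDriveLaw N νV)).map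
        fun p => siloStep N p.2.1 p.2.2 p.1

/-- One step of the infinite silo model with fractions `u`. -/
def ismStep (u η : ℤ → ℝ) : ℤ → ℝ :=
  fun i => η (i - 1) * u (i - 1) + η (i + 1) * (1 - u (i + 1))

/-- `ν` is invariant for the infinite silo model. -/
def IsISMInvariant (ν : Measure (ℤ → ℝ)) : Prop :=
  ∀ κ : Measure (ℤ → ℝ), IsProductLaw unif01 κ →
    ((ν.prod κ).map fun p => ismStep p.2 p.1) = ν

/-- The shift `τ_1` on configurations. -/
def shift1 (η : ℤ → ℝ) : ℤ → ℝ := fun i => η (i - 1)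

/-- `ν` plays the role of `ν_ρ`: the product of Gamma(2, 2/ρ) laws for `ρ ≠ 0`,
and the point mass at the zero configuration for `ρ = 0`. -/
def IsNuRho (ρ : ℝ) (ν : Measure (ℤ → ℝ)) : Prop :=
  (ρ = 0 → ν = Measure.dirac fun _ => 0) ∧
    (ρ ≠ 0 → IsProductLaw (gammaMeasure 2 (2 / ρ)) ν)



/-- Maximum principle for two walkers in a common random environment killed outside `(0, n)`:
a subsolution with source `r ≤ F` on the diagonal is bounded by an explicit supersolution. -/
lemma two_walker_le (n : ℤ) (h : ℤ → ℤ → ℝ) (r : ℤ → ℝ) (F : ℝ) (hF : 0 ≤ F)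
    (hbdry : ∀ i j, (i = 0 ∨ i = n ∨ j = 0 ∨ j = n) → h i j = 0)
    (hoff : ∀ i j, 0 < i → i < n → 0 < j → j < n → i ≠ j →
      h i j = (h (i + 1) (j + 1) + h (i + 1) (j - 1) + h (i - 1) (j + 1) + h (i - 1) (j - 1)) / 4)
    (hdiag : ∀ i, 0 < i → i < n →
      h i i = (h (i + 1) (i + 1) + h (i - 1) (i - 1)) / 3 +
        (h (i + 1) (i - 1) + h (i - 1) (i + 1)) / 6 + r i)
    (hr : ∀ i, 0 < i → i < n → r i ≤ F)
    (i j : ℤ) (hi0 : 0 ≤ i) (hin : i ≤ n) (hj0 : 0 ≤ j) (hjn : j ≤ n) :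
    h i j ≤ 3 / 2 * F * (n - |(i : ℝ) - j|) + i * (n - i) := by
  set K : ℤ → ℤ → ℝ := fun i j => 3 / 2 * F * (n - |(i : ℝ) - j|) + i * (n - i) with hK
  suffices hs : h i j - K i j ≤ 0 by simp only [hK] at hs; linarith
  obtain ⟨⟨a, b⟩, hab, hmax⟩ := Finset.exists_max_image
    (Finset.Icc (0 : ℤ) n ×ˢ Finset.Icc (0 : ℤ) n) (fun p => h p.1 p.2 - K p.1 p.2)
    ⟨(i, j), by simp; omega⟩
  simp only [Finset.mem_product, Finset.mem_Icc] at hab hmax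
  have hle : ∀ x y : ℤ, 0 ≤ x → x ≤ n → 0 ≤ y → y ≤ n → h x y - K x y ≤ h a b - K a b :=
    fun x y h1 h2 h3 h4 => hmax (x, y) ⟨⟨h1, h2⟩, h3, h4⟩
  refine (hle i j hi0 hin hj0 hjn).trans ?_
  obtain ⟨⟨ha0, han⟩, hb0, hbn⟩ := hab
  by_cases hb : a = 0 ∨ a = n ∨ b = 0 ∨ b = n
  · have e1 : (0 : ℝ) ≤ a := by exact_mod_cast ha0
    have e2 : (a : ℝ) ≤ n := by exact_mod_cast han
    have e3 : (0 : ℝ) ≤ b := by exact_mod_cast hb0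
    have e4 : (b : ℝ) ≤ n := by exact_mod_cast hbn
    have : |(a : ℝ) - b| ≤ n := abs_le.2 ⟨by linarith, by linarith⟩
    have h1 : 0 ≤ 3 / 2 * F * (n - |(a : ℝ) - b|) := mul_nonneg (by linarith) (by linarith)
    have h2 : (0 : ℝ) ≤ a * (n - a) := mul_nonneg e1 (by linarith)
    rw [hbdry a b hb]
    simp only [hK]
    linarith
  push Not at hb
  have ha1 : 0 < a := by omega
  have ha2 : a < n := by omega
  have hb1 : 0 < b := by omega
  have hb2 : b < n := by omega
  exfalso
  have q1 := hle (a + 1) (b + 1) (by omega) (by omega) (by omega) (by omega)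
  have q2 := hle (a + 1) (b - 1) (by omega) (by omega) (by omega) (by omega)
  have q3 := hle (a - 1) (b + 1) (by omega) (by omega) (by omega) (by omega)
  have q4 := hle (a - 1) (b - 1) (by omega) (by omega) (by omega) (by omega)
  simp only [hK] at q1 q2 q3 q4
  push_cast at q1 q2 q3 q4
  by_cases hne : a = b
  · subst hne
    have := hdiag a ha1 ha2
    have := hr a ha1 ha2
    rw [show (a : ℝ) + 1 - (a + 1) = 0 by ring, show (a : ℝ) - a = 0 by ring, abs_zero] at q1
    rw [show (a : ℝ) + 1 - (a - 1) = 2 by ring, show (a : ℝ) - a = 0 by ring, abs_zero,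
      abs_of_pos two_pos] at q2
    rw [show (a : ℝ) - 1 - (a + 1) = -2 by ring, show (a : ℝ) - a = 0 by ring, abs_zero, abs_neg,
      abs_of_pos two_pos] at q3
    rw [show (a : ℝ) - 1 - (a - 1) = 0 by ring, show (a : ℝ) - a = 0 by ring, abs_zero] at q4
    linarith
  · have := hoff a b ha1 ha2 hb1 hb2 hne
    rw [show (a : ℝ) + 1 - (b + 1) = a - b by ring] at q1
    rw [show (a : ℝ) + 1 - (b - 1) = a - b + 2 by ring] at q2
    rw [show (a : ℝ) - 1 - (b + 1) = a - b - 2 by ring] at q3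
    rw [show (a : ℝ) - 1 - (b - 1) = a - b by ring] at q4
    have hconv : 2 * |(a : ℝ) - b| ≤ |(a : ℝ) - b + 2| + |(a : ℝ) - b - 2| := by
      have := abs_add_le ((a : ℝ) - b + 2) ((a : ℝ) - b - 2)
      rwa [show (a : ℝ) - b + 2 + (a - b - 2) = 2 * (a - b) by ring, abs_mul,
        abs_of_pos two_pos] at this
    have := mul_le_mul_of_nonneg_left hconv hF
    linarith

/-- If `σ` is the solution of the pair-correlation equations with zero boundary values and source
of size `F` on the diagonal, then the diagonal of `σ` is at most `9 F n / 4 + 3 i (n - i) / 2`. -/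
lemma abs_diag_le_of_pair_equation (n : ℤ) (e : ℤ → ℤ → ℝ) (f : ℤ → ℝ) (F : ℝ) (hF : 0 ≤ F)
    (hbdry : ∀ i j, (i = 0 ∨ i = n ∨ j = 0 ∨ j = n) → e i j = 0)
    (heq : ∀ i j, 0 < i → i < n → 0 < j → j < n →
      e i j = (e (i + 1) (j + 1) + e (i + 1) (j - 1) + e (i - 1) (j + 1) + e (i - 1) (j - 1)) / 4 +
        ((if i = j then e (i + 1) (i + 1) + e (i - 1) (i - 1) else 0)
          - (if i + 1 = j - 1 then e (i + 1) (i + 1) else 0)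
          - (if i - 1 = j + 1 then e (i - 1) (i - 1) else 0)) / 12 +
        (if i = j then f i else 0))
    (hf : ∀ i, 0 < i → i < n → |f i| ≤ F)
    (i : ℤ) (hi0 : 0 ≤ i) (hin : i ≤ n) :
    |e i i| ≤ 3 / 2 * F * n + 3 / 2 * (i * (n - i)) := by
  set h : ℤ → ℤ → ℝ := fun i j => if i = j then 2 / 3 * e i j else e i j with hh
  have hb : ∀ i j, (i = 0 ∨ i = n ∨ j = 0 ∨ j = n) → h i j = 0 := by
    intro i j hij
    simp [hh, hbdry i j hij]
  have hoff : ∀ i j, 0 < i → i < n → 0 < j → j < n → i ≠ j → h i j =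
      (h (i + 1) (j + 1) + h (i + 1) (j - 1) + h (i - 1) (j + 1) + h (i - 1) (j - 1)) / 4 := by
    intro i j h1 h2 h3 h4 hne
    have := heq i j h1 h2 h3 h4
    rcases eq_or_ne (i + 1) (j - 1) with hj | hj
    · obtain rfl : j = i + 2 := by omega
      simp only [hh]
      rw [if_neg (by omega), if_neg (by omega), if_pos (by omega), if_neg (by omega),
        if_neg (by omega)]
      rw [if_neg (by omega), if_pos (by omega), if_neg (by omega), if_neg (by omega)] at this
      rw [show i + 2 - 1 = i + 1 by ring] at *
      linarith
    rcases eq_or_ne (i - 1) (j + 1) with hj' | hj'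
    · obtain rfl : i = j + 2 := by omega
      simp only [hh]
      rw [if_neg (by omega), if_neg (by omega), if_neg (by omega), if_pos (by omega),
        if_neg (by omega)]
      rw [if_neg (by omega), if_neg (by omega), if_pos (by omega), if_neg (by omega)] at this
      rw [show j + 2 - 1 = j + 1 by ring] at *
      linarith
    · simp only [hh]
      rw [if_neg (by omega), if_neg (by omega), if_neg (by omega), if_neg (by omega),
        if_neg (by omega)]
      rw [if_neg (by omega), if_neg (by omega), if_neg (by omega), if_neg (by omega)] at this
      linarith
  have hdiag : ∀ i, 0 < i → i < n →
      h i i = (h (i + 1) (i + 1) + h (i - 1) (i - 1)) / 3 +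
        (h (i + 1) (i - 1) + h (i - 1) (i + 1)) / 6 + 2 / 3 * f i := by
    intro i h1 h2
    have := heq i i h1 h2 h1 h2
    simp only [hh, if_true]
    rw [if_neg (by omega), if_neg (by omega)]
    rw [if_pos rfl, if_neg (by omega), if_neg (by omega), if_pos rfl] at this
    linarith
  have up := two_walker_le n h (fun i => 2 / 3 * f i) (2 / 3 * F) (by linarith) hb hoff hdiag
    (fun i h1 h2 => by have := (abs_le.1 (hf i h1 h2)).2; linarith) i i hi0 hin hi0 hin
  have dn := two_walker_le n (fun i j => - h i j) (fun i => -(2 / 3 * f i)) (2 / 3 * F)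
    (by linarith) (fun i j hij => by simp [hb i j hij])
    (fun i j h1 h2 h3 h4 h5 => by have := hoff i j h1 h2 h3 h4 h5; linarith)
    (fun i h1 h2 => by have := hdiag i h1 h2; linarith)
    (fun i h1 h2 => by have := (abs_le.1 (hf i h1 h2)).1; linarith) i i hi0 hin hi0 hin
  have hii : h i i = 2 / 3 * e i i := by simp [hh]
  rw [sub_self, abs_zero, hii] at up dn
  exact abs_le.2 ⟨by linarith, by linarith⟩

lemma sum_Icc_int_telescope (g : ℤ → ℝ) (n : ℕ) :
    ∑ i ∈ Finset.Icc (1 : ℤ) n, (g i - g (i - 1)) = g n - g 0 := by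
  induction n with
  | zero => simp
  | succ k ih =>
    have : Finset.Icc (1 : ℤ) ((k + 1 : ℕ) : ℤ)
        = insert ((k : ℤ) + 1) (Finset.Icc (1 : ℤ) k) := by
      ext x; simp; omega
    rw [this, Finset.sum_insert (by simp), ih]
    push_cast
    rw [add_sub_cancel_right]
    ring

/-- The equilibrium profile is the only solution of the mean equation with zero boundary values. -/
lemma eq_profile_of_mean_equation (N : ℕ) (M : ℤ → ℝ) (h0 : M 0 = 0) (hN : M (N + 1) = 0)
    (hM : ∀ i : ℤ, 1 ≤ i → i ≤ N → M i = 1 + (M (i + 1) + M (i - 1)) / 2)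
    (i : ℤ) (hi0 : 0 ≤ i) (hin : i ≤ N + 1) : M i = i * (N + 1 - i) := by
  have key : ∀ k : ℕ, k ≤ N → M k = k * (M 1 + 1 - k) ∧ M (k + 1) = (k + 1) * (M 1 - k) := by
    intro k
    induction k with
    | zero => simp [h0]
    | succ k ih =>
      intro hk
      obtain ⟨h1, h2⟩ := ih (by omega)
      have := hM (k + 1) (by omega) (by omega)
      rw [add_sub_cancel_right] at this
      push_cast
      exact ⟨by rw [h2]; ring, by linarith⟩
  have hend := (key N le_rfl).2
  rw [hN] at hend
  have hM1 : M 1 = N := by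
    rcases mul_eq_zero.1 hend.symm with h | h
    · exact absurd h (by positivity)
    · linarith
  lift i to ℕ using hi0
  rcases Nat.lt_or_ge N i with h | h
  · obtain rfl : i = N + 1 := by omega
    push_cast
    rw [hN]; ring
  · rw [(key i h).1, hM1]; push_cast; ring

/-- Foster–Lyapunov bound: if one random step contracts `L` up to an integrable error, then `L` is
integrable under every invariant probability measure. -/
lemma lintegral_lt_top_of_drift {Ω Ω' : Type*} [MeasurableSpace Ω] [MeasurableSpace Ω']
    {μ : Measure Ω} [IsProbabilityMeasure μ] {D : Measure Ω'} [IsProbabilityMeasure D]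
    {S : Ω × Ω' → Ω} (hS : MeasurePreserving S (μ.prod D) μ) {L B : Ω → ENNReal}
    (hL : Measurable L) (hLtop : ∀ w, L w ≠ ⊤) (hB : ∫⁻ w, B w ∂μ ≠ ⊤)
    {c : ENNReal} (hc : c < 1)
    (hdrift : ∀ᵐ w ∂μ, ∫⁻ d, L (S (w, d)) ∂D ≤ c * L w + B w) :
    ∫⁻ w, L w ∂μ < ⊤ := by
  set b := ∫⁻ w, B w ∂μ with hb
  have hbound : ∀ M : ℕ, ∫⁻ w in {w | L w < M}, L w ∂μ ≤ b / (1 - c) := by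
    intro M
    set A := {w | L w < M} with hA
    have hAm : MeasurableSet A := measurableSet_lt hL measurable_const
    have hstep : ∫⁻ w, min (L w) M ∂μ ≤ ∫⁻ w, min (c * L w + B w) M ∂μ := by
      have hm : Measurable fun w => min (L w) (M : ENNReal) := hL.min measurable_const
      rw [← hS.lintegral_comp hm, lintegral_prod (fun z => min (L (S z)) (M : ENNReal)) (hm.comp hS.measurable).aemeasurable]
      refine lintegral_mono_ae ?_
      filter_upwards [hdrift] with w hw
      refine le_min (le_trans (lintegral_mono fun d => min_le_left _ _) hw) ?_
      refine (lintegral_mono fun d => min_le_right _ _).trans ?_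
      simp
    rw [← lintegral_add_compl (fun w => min (L w) (M : ENNReal)) hAm,
      ← lintegral_add_compl (fun w => min (c * L w + B w) (M : ENNReal)) hAm] at hstep
    have e1 : ∫⁻ w in A, min (L w) M ∂μ = ∫⁻ w in A, L w ∂μ :=
      setLIntegral_congr_fun hAm fun w hw => min_eq_left (le_of_lt hw)
    have e2 : ∫⁻ w in Aᶜ, min (L w) M ∂μ = M * μ Aᶜ := by
      rw [← setLIntegral_const]
      exact setLIntegral_congr_fun hAm.compl fun w hw => min_eq_right (not_lt.1 hw)
    have e3 : ∫⁻ w in Aᶜ, min (c * L w + B w) M ∂μ ≤ M * μ Aᶜ := by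
      rw [← setLIntegral_const]
      exact lintegral_mono fun w => min_le_right _ _
    have hMA : (M : ENNReal) * μ Aᶜ ≠ ⊤ :=
      ENNReal.mul_ne_top (ENNReal.natCast_ne_top _) (measure_ne_top _ _)
    have e4 : ∫⁻ w in A, min (c * L w + B w) M ∂μ ≤ c * ∫⁻ w in A, L w ∂μ + b := by
      refine (lintegral_mono fun w => min_le_left _ _).trans ?_
      rw [lintegral_add_left (hL.const_mul c), lintegral_const_mul c hL]
      gcongr
      exact setLIntegral_le_lintegral _ _
    rw [e1, e2] at hstep
    have h5 : ∫⁻ w in A, L w ∂μ ≤ c * ∫⁻ w in A, L w ∂μ + b :=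
      ((ENNReal.add_le_add_iff_right hMA).1 (hstep.trans (add_le_add le_rfl e3))).trans e4
    have hfin : ∫⁻ w in A, L w ∂μ ≠ ⊤ := by
      refine ne_top_of_le_ne_top (b := (M : ENNReal) * μ A)
        (ENNReal.mul_ne_top (ENNReal.natCast_ne_top _) (measure_ne_top _ _)) ?_
      rw [← setLIntegral_const]
      exact setLIntegral_mono measurable_const fun w hw => le_of_lt hw
    rw [ENNReal.le_div_iff_mul_le (Or.inl (tsub_pos_of_lt hc).ne')
      (Or.inl (ENNReal.sub_ne_top ENNReal.one_ne_top)), ENNReal.mul_sub (fun _ _ => hfin), mul_one,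
      mul_comm]
    exact tsub_le_iff_left.2 h5
  have hU : (⋃ M : ℕ, {w | L w < M}) = Set.univ := by
    refine Set.eq_univ_of_forall fun w => Set.mem_iUnion.2 ?_
    exact ENNReal.exists_nat_gt (hLtop w)
  have hdir : Directed (· ⊆ ·) fun M : ℕ => {w | L w < M} :=
    directed_of_isDirected_le fun a b hab w hw => (show L w < a from hw).trans_le (Nat.cast_le.2 hab)
  rw [← setLIntegral_univ, ← hU, setLIntegral_iUnion_of_directed _ hdir]
  exact (iSup_le hbound).trans_lt (ENNReal.div_lt_top hB (tsub_pos_of_lt hc).ne')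

lemma integrable_of_drift {Ω Ω' : Type*} [MeasurableSpace Ω] [MeasurableSpace Ω']
    {μ : Measure Ω} [IsProbabilityMeasure μ] {D : Measure Ω'} [IsProbabilityMeasure D]
    {S : Ω × Ω' → Ω} (hS : MeasurePreserving S (μ.prod D) μ) {L B : Ω → ℝ}
    (hL : Measurable L) (hL0 : ∀ᵐ w ∂μ, 0 ≤ L w) (hB : Integrable B μ)
    {c : ℝ} (hc0 : 0 ≤ c) (hc : c < 1)
    (hdrift : ∀ᵐ w ∂μ, ∃ R : Ω' → ℝ, Integrable R D ∧
      (∀ᵐ d ∂D, 0 ≤ R d ∧ L (S (w, d)) ≤ R d) ∧ ∫ d, R d ∂D ≤ c * L w + B w) :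
    Integrable L μ := by
  refine ⟨hL.aestronglyMeasurable, (hasFiniteIntegral_iff_ofReal hL0).2 ?_⟩
  refine lintegral_lt_top_of_drift hS (B := fun w => ENNReal.ofReal (B w))
    (c := ENNReal.ofReal c) hL.ennreal_ofReal (fun w => ENNReal.ofReal_ne_top)
    hB.lintegral_lt_top.ne (by simpa using hc) ?_
  filter_upwards [hdrift] with w ⟨R, hR, hRd, hRint⟩
  calc ∫⁻ d, ENNReal.ofReal (L (S (w, d))) ∂D
      ≤ ∫⁻ d, ENNReal.ofReal (R d) ∂D :=
        lintegral_mono_ae (hRd.mono fun d hd => ENNReal.ofReal_le_ofReal hd.2)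
    _ = ENNReal.ofReal (∫ d, R d ∂D) :=
        (ofReal_integral_eq_lintegral_ofReal hR (hRd.mono fun d hd => hd.1)).symm
    _ ≤ ENNReal.ofReal (c * L w + B w) := ENNReal.ofReal_le_ofReal hRint
    _ ≤ ENNReal.ofReal (c * L w) + ENNReal.ofReal (B w) := ENNReal.ofReal_add_le
    _ = ENNReal.ofReal c * ENNReal.ofReal (L w) + ENNReal.ofReal (B w) := by
        rw [ENNReal.ofReal_mul hc0]

section DriveLaw

variable {I : Finset ℤ} {m : Measure ℝ}

lemma measurable_extend_zero (I : Finset ℤ) :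
    Measurable fun (f : I → ℝ) (i : ℤ) => if h : i ∈ I then f ⟨i, h⟩ else 0 := by
  refine measurable_pi_lambda _ fun i => ?_
  by_cases h : i ∈ I
  · simpa [h] using measurable_pi_apply _
  · simp [h]

instance [IsProbabilityMeasure m] : IsProbabilityMeasure (finExtLaw I m) :=
  Measure.isProbabilityMeasure_map (measurable_extend_zero I).aemeasurable

lemma measurePreserving_finExtLaw [IsProbabilityMeasure m] {i : ℤ} (hi : i ∈ I) :
    MeasurePreserving (fun f : ℤ → ℝ => f i) (finExtLaw I m) m := by
  refine ⟨measurable_pi_apply i, ?_⟩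
  rw [finExtLaw, Measure.map_map (measurable_pi_apply i) (measurable_extend_zero I)]
  refine Eq.trans ?_ (measurePreserving_eval (fun _ : I => m) ⟨i, hi⟩).map_eq
  congr 1
  ext f
  simp [hi]

lemma finExtLaw_ae_eq_zero [IsProbabilityMeasure m] {i : ℤ} (hi : i ∉ I) :
    ∀ᵐ f ∂finExtLaw I m, f i = 0 := by
  rw [finExtLaw, ae_map_iff (measurable_extend_zero I).aemeasurable
    (measurableSet_eq_fun (measurable_pi_apply i) measurable_const)]
  simp [hi]

lemma finExtLaw_ae_forall [IsProbabilityMeasure m] {p : ℝ → Prop} (hp : ∀ᵐ x ∂m, p x) (h0 : p 0) :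
    ∀ᵐ f ∂finExtLaw I m, ∀ i, p (f i) := by
  refine ae_all_iff.2 fun i => ?_
  by_cases hi : i ∈ I
  · exact (measurePreserving_finExtLaw hi).quasiMeasurePreserving.ae hp
  · filter_upwards [finExtLaw_ae_eq_zero hi] with f hf
    rwa [hf]

lemma indepFun_finExtLaw [IsProbabilityMeasure m] {i j : ℤ} (hi : i ∈ I) (hj : j ∈ I)
    (hij : i ≠ j) : IndepFun (fun f : ℤ → ℝ => f i) (fun f => f j) (finExtLaw I m) := by
  have h := (iIndepFun_pi (μ := fun _ : I => m) (X := fun _ => id)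
    (fun _ => aemeasurable_id)).indepFun (i := ⟨i, hi⟩) (j := ⟨j, hj⟩) (by simpa using hij)
  rw [indepFun_iff_measure_inter_preimage_eq_mul] at h ⊢
  intro s t hs ht
  have := h s t hs ht
  have hs' : MeasurableSet ((fun f : ℤ → ℝ => f i) ⁻¹' s) := measurable_pi_apply i hs
  have ht' : MeasurableSet ((fun f : ℤ → ℝ => f j) ⁻¹' t) := measurable_pi_apply j ht
  rw [finExtLaw, Measure.map_apply (measurable_extend_zero I) (hs'.inter ht'),
    Measure.map_apply (measurable_extend_zero I) hs',
    Measure.map_apply (measurable_extend_zero I) ht']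
  simpa [Set.preimage_inter, ← Set.preimage_comp, Function.comp_def, hi, hj] using this

lemma memLp_finExtLaw [IsProbabilityMeasure m] (hm : MemLp (fun x : ℝ => x) 2 m) (i : ℤ) :
    MemLp (fun f : ℤ → ℝ => f i) 2 (finExtLaw I m) := by
  by_cases hi : i ∈ I
  · exact hm.comp_measurePreserving (measurePreserving_finExtLaw hi)
  · exact (memLp_congr_ae (f := fun _ => (0 : ℝ))
      ((finExtLaw_ae_eq_zero hi).mono fun f hf => hf.symm)).1 (memLp_const 0)

lemma integral_finExtLaw [IsProbabilityMeasure m] {i : ℤ} (hi : i ∈ I) :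
    ∫ f, f i ∂finExtLaw I m = ∫ x, x ∂m := by
  have h := measurePreserving_finExtLaw (m := m) hi
  conv_rhs => rw [← h.map_eq]
  rw [integral_map h.measurable.aemeasurable (by fun_prop)]

lemma covariance_finExtLaw [IsProbabilityMeasure m] (hm : MemLp (fun x : ℝ => x) 2 m)
    {i j : ℤ} (hi : i ∈ I) (hj : j ∈ I) :
    cov[fun f : ℤ → ℝ => f i, fun f => f j; finExtLaw I m] =
      if i = j then cov[fun x => x, fun x => x; m] else 0 := by
  split_ifs with hij
  · subst hij
    have h := measurePreserving_finExtLaw (m := m) hi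
    conv_rhs => rw [← h.map_eq]
    rw [covariance_map_fun (by fun_prop) (by fun_prop) h.measurable.aemeasurable]
  · exact (indepFun_finExtLaw hi hj hij).covariance_eq_zero (memLp_finExtLaw hm i)
      (memLp_finExtLaw hm j)

instance : IsProbabilityMeasure unif01 := ⟨by simp [unif01]⟩

lemma memLp_unif01 : MemLp (fun x : ℝ => x) 2 unif01 :=
  MemLp.of_bound (by fun_prop) 1 <| by
    rw [unif01]
    filter_upwards [ae_restrict_mem measurableSet_Icc] with x hx
    rw [Real.norm_eq_abs, abs_of_nonneg hx.1]
    exact hx.2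

lemma integral_unif01 : ∫ x, x ∂unif01 = 1 / 2 := by
  rw [unif01, integral_Icc_eq_integral_Ioc, ← intervalIntegral.integral_of_le zero_le_one]
  simp

lemma covariance_unif01 : cov[fun x : ℝ => x, fun x => x; unif01] = 1 / 12 := by
  rw [covariance_eq_sub memLp_unif01 memLp_unif01, integral_unif01]
  have : ∫ x, (x : ℝ) ^ 2 ∂unif01 = 1 / 3 := by
    rw [unif01, integral_Icc_eq_integral_Ioc, ← intervalIntegral.integral_of_le zero_le_one]
    norm_num
  simp only [Pi.mul_apply, ← pow_two] at this ⊢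
  rw [this]; norm_num

end DriveLaw

section SiloStep

variable {N : ℕ} {νV : Measure ℝ}

instance [IsProbabilityMeasure νV] : IsProbabilityMeasure (siloDriveLaw N νV) := by
  unfold siloDriveLaw; infer_instance

/-- The weight passed to site `i` from its neighbours, together with the fresh weight there. -/
def siloUpdate (x : ℤ → ℝ) (i : ℤ) (d : (ℤ → ℝ) × (ℤ → ℝ)) : ℝ :=
  d.2 i + x (i + 1) * d.1 (i + 1) + x (i - 1) * (1 - d.1 (i - 1))

variable [IsProbabilityMeasure νV]

lemma memLp_fraction (a : ℤ) :
    MemLp (fun d : (ℤ → ℝ) × (ℤ → ℝ) => d.1 a) 2 (siloDriveLaw N νV) :=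
  (memLp_finExtLaw memLp_unif01 a).comp_measurePreserving measurePreserving_fst

lemma memLp_grain (hm : MemLp (fun x : ℝ => x) 2 νV) (i : ℤ) :
    MemLp (fun d : (ℤ → ℝ) × (ℤ → ℝ) => d.2 i) 2 (siloDriveLaw N νV) :=
  (memLp_finExtLaw hm i).comp_measurePreserving measurePreserving_snd

lemma integral_fraction {a : ℤ} (h0 : 0 ≤ a) (h1 : a ≤ N + 1) :
    ∫ d, d.1 a ∂siloDriveLaw N νV = 1 / 2 := by
  rw [← integral_unif01, ← integral_finExtLaw (m := unif01) (Finset.mem_Icc.2 ⟨h0, h1⟩),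
    siloDriveLaw, integral_fun_fst (f := fun f : ℤ → ℝ => f a)]
  simp

lemma integral_grain {i : ℤ} (h1 : 1 ≤ i) (h2 : i ≤ N) :
    ∫ d, d.2 i ∂siloDriveLaw N νV = ∫ x, x ∂νV := by
  rw [← integral_finExtLaw (m := νV) (Finset.mem_Icc.2 ⟨h1, h2⟩),
    siloDriveLaw, integral_fun_snd (f := fun f : ℤ → ℝ => f i)]
  simp

lemma covariance_fraction {a b : ℤ} (ha : 0 ≤ a) (ha' : a ≤ N + 1) (hb : 0 ≤ b)
    (hb' : b ≤ N + 1) :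
    cov[fun d : (ℤ → ℝ) × (ℤ → ℝ) => d.1 a, fun d => d.1 b; siloDriveLaw N νV] =
      if a = b then 1 / 12 else 0 := by
  rw [← covariance_unif01, ← covariance_finExtLaw memLp_unif01 (Finset.mem_Icc.2 ⟨ha, ha'⟩)
    (Finset.mem_Icc.2 ⟨hb, hb'⟩)]
  conv_rhs => rw [← (measurePreserving_fst (μ := finExtLaw (Finset.Icc 0 ((N : ℤ) + 1)) unif01)
    (ν := finExtLaw (Finset.Icc 1 (N : ℤ)) νV)).map_eq]
  rw [covariance_map_fun (measurable_pi_apply _).aestronglyMeasurable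
    (measurable_pi_apply _).aestronglyMeasurable measurable_fst.aemeasurable]
  rfl

lemma covariance_grain (hm : MemLp (fun x : ℝ => x) 2 νV) {i j : ℤ} (hi : 1 ≤ i) (hi' : i ≤ N)
    (hj : 1 ≤ j) (hj' : j ≤ N) :
    cov[fun d : (ℤ → ℝ) × (ℤ → ℝ) => d.2 i, fun d => d.2 j; siloDriveLaw N νV] =
      if i = j then cov[fun x => x, fun x => x; νV] else 0 := by
  rw [← covariance_finExtLaw hm (Finset.mem_Icc.2 ⟨hi, hi'⟩) (Finset.mem_Icc.2 ⟨hj, hj'⟩)]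
  conv_rhs => rw [← (measurePreserving_snd (μ := finExtLaw (Finset.Icc 0 ((N : ℤ) + 1)) unif01)
    (ν := finExtLaw (Finset.Icc 1 (N : ℤ)) νV)).map_eq]
  rw [covariance_map_fun (measurable_pi_apply _).aestronglyMeasurable
    (measurable_pi_apply _).aestronglyMeasurable measurable_snd.aemeasurable]
  rfl

lemma covariance_fraction_grain (hm : MemLp (fun x : ℝ => x) 2 νV) (a i : ℤ) :
    cov[fun d : (ℤ → ℝ) × (ℤ → ℝ) => d.1 a, fun d => d.2 i; siloDriveLaw N νV] = 0 :=
  covariance_fst_snd_prod (memLp_finExtLaw memLp_unif01 a) (memLp_finExtLaw hm i)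

lemma siloUpdate_eq (x : ℤ → ℝ) (i : ℤ) :
    siloUpdate x i = fun d => ((fun d : (ℤ → ℝ) × (ℤ → ℝ) => d.2 i) +
      x (i + 1) • (fun d : (ℤ → ℝ) × (ℤ → ℝ) => d.1 (i + 1)) -
      x (i - 1) • (fun d : (ℤ → ℝ) × (ℤ → ℝ) => d.1 (i - 1))) d + x (i - 1) := by
  ext d
  simp [siloUpdate]
  ring

lemma memLp_siloUpdate (hm : MemLp (fun x : ℝ => x) 2 νV) (x : ℤ → ℝ) (i : ℤ) :
    MemLp (siloUpdate x i) 2 (siloDriveLaw N νV) := by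
  rw [siloUpdate_eq]
  exact (((memLp_grain hm i).add ((memLp_fraction _).const_smul _)).sub
    ((memLp_fraction _).const_smul _)).add (memLp_const _)

lemma integral_siloUpdate (hm : MemLp (fun x : ℝ => x) 2 νV) (hmean : ∫ x, x ∂νV = 1)
    (x : ℤ → ℝ) {i : ℤ} (hi : 1 ≤ i) (hi' : i ≤ N) :
    ∫ d, siloUpdate x i d ∂siloDriveLaw N νV = 1 + (x (i + 1) + x (i - 1)) / 2 := by
  have hu := fun a => (memLp_fraction (N := N) (νV := νV) a).integrable one_le_two
  have hv := (memLp_grain (N := N) hm i).integrable one_le_two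
  have h1 := (hu (i + 1)).const_mul (x (i + 1))
  have h2 : Integrable (fun d : (ℤ → ℝ) × (ℤ → ℝ) => x (i - 1) * (1 - d.1 (i - 1)))
      (siloDriveLaw N νV) := ((integrable_const _).sub (hu _)).const_mul _
  have h3 : Integrable (fun d : (ℤ → ℝ) × (ℤ → ℝ) => d.2 i + x (i + 1) * d.1 (i + 1))
      (siloDriveLaw N νV) := hv.add h1
  simp only [siloUpdate]
  rw [integral_add h3 h2, integral_add hv h1, integral_const_mul, integral_const_mul,
    integral_sub (integrable_const _) (hu _), integral_grain hi hi', hmean,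
    integral_fraction (by omega) (by omega), integral_fraction (by omega) (by omega)]
  simp
  ring

lemma covariance_siloUpdate (hm : MemLp (fun x : ℝ => x) 2 νV) (x : ℤ → ℝ) (i : ℤ)
    {Z : (ℤ → ℝ) × (ℤ → ℝ) → ℝ} (hZ : MemLp Z 2 (siloDriveLaw N νV)) :
    cov[siloUpdate x i, Z; siloDriveLaw N νV] =
      cov[fun d => d.2 i, Z; siloDriveLaw N νV]
        + x (i + 1) * cov[fun d => d.1 (i + 1), Z; siloDriveLaw N νV]
        - x (i - 1) * cov[fun d => d.1 (i - 1), Z; siloDriveLaw N νV] := by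
  have h1 := (memLp_grain (N := N) hm i).add
    ((memLp_fraction (N := N) (νV := νV) (i + 1)).const_smul (x (i + 1)))
  have h2 := (memLp_fraction (N := N) (νV := νV) (i - 1)).const_smul (x (i - 1))
  rw [siloUpdate_eq, covariance_add_const_left ((h1.sub h2).integrable one_le_two),
    covariance_sub_left h1 h2 hZ,
    covariance_add_left (memLp_grain hm i) ((memLp_fraction _).const_smul _) hZ,
    covariance_smul_left, covariance_smul_left]

lemma covariance_siloUpdate_grain (hm : MemLp (fun x : ℝ => x) 2 νV) (x : ℤ → ℝ) {i j : ℤ}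
    (hi : 1 ≤ i) (hi' : i ≤ N) (hj : 1 ≤ j) (hj' : j ≤ N) :
    cov[siloUpdate x i, fun d => d.2 j; siloDriveLaw N νV] =
      if i = j then cov[fun x => x, fun x => x; νV] else 0 := by
  rw [covariance_siloUpdate hm x i (memLp_grain hm j), covariance_grain hm hi hi' hj hj',
    covariance_fraction_grain hm, covariance_fraction_grain hm]
  ring

lemma covariance_siloUpdate_fraction (hm : MemLp (fun x : ℝ => x) 2 νV) (x : ℤ → ℝ) {i a : ℤ}
    (hi : 1 ≤ i) (hi' : i ≤ N) (ha : 0 ≤ a) (ha' : a ≤ N + 1) :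
    cov[siloUpdate x i, fun d => d.1 a; siloDriveLaw N νV] =
      ((if i + 1 = a then x (i + 1) else 0) - (if i - 1 = a then x (i - 1) else 0)) / 12 := by
  rw [covariance_siloUpdate hm x i (memLp_fraction a), covariance_comm,
    covariance_fraction_grain hm,
    covariance_fraction (by omega) (by omega) ha ha',
    covariance_fraction (by omega) (by omega) ha ha']
  split_ifs <;> ring

lemma covariance_siloUpdate_siloUpdate (hm : MemLp (fun x : ℝ => x) 2 νV) (x : ℤ → ℝ) {i j : ℤ}
    (hi : 1 ≤ i) (hi' : i ≤ N) (hj : 1 ≤ j) (hj' : j ≤ N) :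
    cov[siloUpdate x i, siloUpdate x j; siloDriveLaw N νV] =
      (if i = j then cov[fun x => x, fun x => x; νV] else 0) +
        ((if i = j then x (i + 1) * x (i + 1) + x (i - 1) * x (i - 1) else 0)
          - (if i + 1 = j - 1 then x (i + 1) * x (i + 1) else 0)
          - (if i - 1 = j + 1 then x (i - 1) * x (i - 1) else 0)) / 12 := by
  rw [covariance_comm, covariance_siloUpdate hm x j (memLp_siloUpdate hm x i),
    covariance_comm _ (siloUpdate x i), covariance_siloUpdate_grain hm x hi hi' hj hj',
    covariance_comm _ (siloUpdate x i),
    covariance_siloUpdate_fraction hm x hi hi' (by omega) (by omega),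
    covariance_comm _ (siloUpdate x i), covariance_siloUpdate_fraction hm x hi hi' (by omega) (by omega)]
  have e1 : i + 1 = j + 1 ↔ i = j := by omega
  have e2 : i - 1 = j - 1 ↔ i = j := by omega
  simp only [e1, e2]
  rcases eq_or_ne i j with h | h
  · subst h
    have n1 : ¬i + 1 = i - 1 := by omega
    have n2 : ¬i - 1 = i + 1 := by omega
    simp only [n1, n2, if_true, if_false]
    ring
  · rw [if_neg h, if_neg h, if_neg h, if_neg h]
    rcases eq_or_ne (i + 1) (j - 1) with h' | h'
    · rw [← h', if_pos rfl, if_pos rfl, if_neg (by omega), if_neg (by omega)]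
      ring
    · rw [if_neg h', if_neg h']
      rcases eq_or_ne (i - 1) (j + 1) with h'' | h''
      · rw [← h'', if_pos rfl, if_pos rfl]
        ring
      · rw [if_neg h'', if_neg h'']
        ring

end SiloStep

section Configurations

variable {N : ℕ}

/-- The equilibrium mean profile `i (N + 1 - i)`. -/
def siloProfile (N : ℕ) (i : ℤ) : ℝ := i * (N + 1 - i)

lemma one_le_siloProfile {i : ℤ} (h1 : 1 ≤ i) (h2 : i ≤ N) : 1 ≤ siloProfile N i := by
  have h1' : (1 : ℝ) ≤ i := by exact_mod_cast h1
  have h2' : (i : ℝ) ≤ N := by exact_mod_cast h2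
  exact one_le_mul_of_one_le_of_one_le h1' (by linarith)

lemma siloProfile_le {i : ℤ} (h1 : 1 ≤ i) (h2 : i ≤ N) : siloProfile N i ≤ (N : ℝ) ^ 2 := by
  have h1' : (1 : ℝ) ≤ i := by exact_mod_cast h1
  have h2' : (i : ℝ) ≤ N := by exact_mod_cast h2
  rw [pow_two]
  exact mul_le_mul h2' (by linarith) (by linarith) (by linarith)

/-- Configurations with nonnegative weights carried by `{1, …, N}`. -/
def IsSiloConfig (N : ℕ) (w : ℤ → ℝ) : Prop :=
  ∀ i : ℤ, 0 ≤ w i ∧ (¬(1 ≤ i ∧ i ≤ (N : ℤ)) → w i = 0)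

/-- Total weight of the configuration in the box. -/
def totalWeight (N : ℕ) (w : ℤ → ℝ) : ℝ := ∑ i ∈ Finset.Icc (1 : ℤ) N, w i

/-- Total weight of the configuration, weighted by the equilibrium profile. -/
def profileWeight (N : ℕ) (w : ℤ → ℝ) : ℝ := ∑ i ∈ Finset.Icc (1 : ℤ) N, siloProfile N i * w i

lemma measurable_totalWeight : Measurable (totalWeight N) := by
  unfold totalWeight; fun_prop

lemma measurable_profileWeight : Measurable (profileWeight N) := by
  unfold profileWeight; fun_prop

variable {w : ℤ → ℝ}

lemma siloStep_eq_siloUpdate (hw : IsSiloConfig N w) {i : ℤ} (h1 : 1 ≤ i) (h2 : i ≤ N)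
    (d : (ℤ → ℝ) × (ℤ → ℝ)) : siloStep N d.1 d.2 w i = siloUpdate w i d := by
  have ht : trunc N w = w := by
    ext k
    by_cases hk : 1 ≤ k ∧ k ≤ (N : ℤ)
    · simp [trunc, hk]
    · rw [trunc, if_neg hk, (hw k).2 hk]
  rw [siloStep, ht, trunc, if_pos ⟨h1, h2⟩, siloUpdate]

lemma totalWeight_nonneg (hw : IsSiloConfig N w) : 0 ≤ totalWeight N w :=
  Finset.sum_nonneg fun i _ => (hw i).1

lemma le_totalWeight (hw : IsSiloConfig N w) {i : ℤ} (h1 : 1 ≤ i) (h2 : i ≤ N) :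
    w i ≤ totalWeight N w :=
  Finset.single_le_sum (f := w) (fun i _ => (hw i).1) (Finset.mem_Icc.2 ⟨h1, h2⟩)

lemma totalWeight_le_profileWeight (hw : IsSiloConfig N w) :
    totalWeight N w ≤ profileWeight N w :=
  Finset.sum_le_sum fun i hi => by
    rw [Finset.mem_Icc] at hi
    exact le_mul_of_one_le_left (hw i).1 (one_le_siloProfile hi.1 hi.2)

lemma profileWeight_le (hw : IsSiloConfig N w) :
    profileWeight N w ≤ (N : ℝ) ^ 2 * totalWeight N w := by
  rw [profileWeight, totalWeight, Finset.mul_sum]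
  refine Finset.sum_le_sum fun i hi => ?_
  rw [Finset.mem_Icc] at hi
  exact mul_le_mul_of_nonneg_right (siloProfile_le hi.1 hi.2) (hw i).1

lemma sum_profile_mul_neighbours (hw : IsSiloConfig N w) :
    ∑ i ∈ Finset.Icc (1 : ℤ) N, siloProfile N i * ((w (i + 1) + w (i - 1)) / 2) =
      profileWeight N w - totalWeight N w := by
  have h := sum_Icc_int_telescope
    (fun i => (siloProfile N i * w (i + 1) - siloProfile N (i + 1) * w i) / 2) N
  have h0 : w 0 = 0 := (hw 0).2 (by omega)
  have hN : w (N + 1) = 0 := (hw _).2 (by omega)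
  rw [← sub_eq_zero, profileWeight, totalWeight, ← Finset.sum_sub_distrib,
    ← Finset.sum_sub_distrib]
  have hr : (siloProfile N N * w (N + 1) - siloProfile N (N + 1) * w N) / 2
      - (siloProfile N 0 * w (0 + 1) - siloProfile N (0 + 1) * w 0) / 2 = 0 := by
    rw [h0, hN]; simp [siloProfile]
  rw [← hr, ← h]
  refine Finset.sum_congr rfl fun i _ => ?_
  rw [sub_add_cancel]
  simp only [siloProfile]
  push_cast
  ring

lemma totalWeight_siloStep_le (hw : IsSiloConfig N w) {d : (ℤ → ℝ) × (ℤ → ℝ)}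
    (hd : ∀ i, 0 ≤ d.1 i ∧ d.1 i ≤ 1) :
    totalWeight N (siloStep N d.1 d.2 w) ≤ totalWeight N d.2 + totalWeight N w := by
  have h := sum_Icc_int_telescope (fun i => w (i + 1) * d.1 (i + 1) - w i * (1 - d.1 i)) N
  have h0 : w 0 = 0 := (hw 0).2 (by omega)
  have hN : w (N + 1) = 0 := (hw _).2 (by omega)
  have hsum : totalWeight N (siloStep N d.1 d.2 w) - (totalWeight N d.2 + totalWeight N w) =
      ∑ i ∈ Finset.Icc (1 : ℤ) N, ((w (i + 1) * d.1 (i + 1) - w i * (1 - d.1 i)) -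
        (w (i - 1 + 1) * d.1 (i - 1 + 1) - w (i - 1) * (1 - d.1 (i - 1)))) := by
    simp only [totalWeight]
    rw [← Finset.sum_add_distrib, ← Finset.sum_sub_distrib]
    refine Finset.sum_congr rfl fun i hi => ?_
    rw [Finset.mem_Icc] at hi
    rw [siloStep_eq_siloUpdate hw hi.1 hi.2, siloUpdate, sub_add_cancel]
    ring
  rw [h, h0, hN, zero_add] at hsum
  have h1 := mul_nonneg (hw N).1 (sub_nonneg.2 (hd N).2)
  have h2 := mul_nonneg (hw 1).1 (hd 1).1
  linarith

lemma siloUpdate_nonneg (hw : IsSiloConfig N w) {d : (ℤ → ℝ) × (ℤ → ℝ)}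
    (hd : ∀ i, 0 ≤ d.1 i ∧ d.1 i ≤ 1) (hd' : ∀ i, 0 ≤ d.2 i) (i : ℤ) : 0 ≤ siloUpdate w i d :=
  add_nonneg (add_nonneg (hd' i) (mul_nonneg (hw _).1 (hd _).1))
    (mul_nonneg (hw _).1 (sub_nonneg.2 (hd _).2))

lemma profileWeight_siloStep (hw : IsSiloConfig N w) (d : (ℤ → ℝ) × (ℤ → ℝ)) :
    profileWeight N (siloStep N d.1 d.2 w) =
      ∑ i ∈ Finset.Icc (1 : ℤ) N, siloProfile N i * siloUpdate w i d :=
  Finset.sum_congr rfl fun i hi => by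
    rw [Finset.mem_Icc] at hi
    rw [siloStep_eq_siloUpdate hw hi.1 hi.2]

lemma measurable_siloStep :
    Measurable fun p : (ℤ → ℝ) × (ℤ → ℝ) × (ℤ → ℝ) => siloStep N p.2.1 p.2.2 p.1 := by
  refine measurable_pi_lambda _ fun i => ?_
  have ht : ∀ k : ℤ, Measurable fun p : (ℤ → ℝ) × (ℤ → ℝ) × (ℤ → ℝ) => trunc N p.1 k := by
    intro k
    unfold trunc
    split_ifs <;> fun_prop
  rw [show (fun p : (ℤ → ℝ) × (ℤ → ℝ) × (ℤ → ℝ) => siloStep N p.2.1 p.2.2 p.1 i) = fun p =>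
    if 1 ≤ i ∧ i ≤ (N : ℤ) then p.2.2 i + trunc N p.1 (i + 1) * p.2.1 (i + 1) +
      trunc N p.1 (i - 1) * (1 - p.2.1 (i - 1)) else 0 from rfl]
  have h1 := ht (i + 1)
  have h2 := ht (i - 1)
  split_ifs <;> fun_prop

end Configurations

section Invariant

variable {N : ℕ} {νV : Measure ℝ} {μ : Measure (ℤ → ℝ)}

lemma IsVLaw.memLp (hνV : IsVLaw νV) : MemLp (fun x : ℝ => x) 2 νV :=
  (memLp_two_iff_integrable_sq (by fun_prop)).2 hνV.2.2.2

lemma siloDriveLaw_ae_bounds (hνV : IsVLaw νV) :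
    ∀ᵐ d ∂siloDriveLaw N νV, (∀ i, 0 ≤ d.1 i ∧ d.1 i ≤ 1) ∧ ∀ i, 0 ≤ d.2 i := by
  have := hνV.1
  have h1 : ∀ᵐ x ∂unif01, 0 ≤ x ∧ x ≤ 1 := ae_restrict_mem measurableSet_Icc
  have h2 : ∀ᵐ x ∂νV, 0 ≤ x := by
    rw [ae_iff]; simpa using hνV.2.1
  exact (measurePreserving_fst.quasiMeasurePreserving.ae
    (finExtLaw_ae_forall h1 ⟨le_rfl, zero_le_one⟩)).and
    (measurePreserving_snd.quasiMeasurePreserving.ae (finExtLaw_ae_forall h2 le_rfl))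

lemma IsSiloInvariant.ae_isSiloConfig (hμ : IsSiloInvariant N νV μ) :
    ∀ᵐ w ∂μ, IsSiloConfig N w := by
  have := hμ.1
  refine (mem_ae_iff_prob_eq_one ?_).2 hμ.2.1
  have hset : {w : ℤ → ℝ | ∀ i : ℤ, 0 ≤ w i ∧ (¬(1 ≤ i ∧ i ≤ (N : ℤ)) → w i = 0)} =
      ⋂ i : ℤ, {w | 0 ≤ w i} ∩ {w | ¬(1 ≤ i ∧ i ≤ (N : ℤ)) → w i = 0} := by
    ext w
    simp only [Set.mem_iInter, Set.mem_inter_iff]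
    rfl
  change MeasurableSet {w : ℤ → ℝ | ∀ i : ℤ, 0 ≤ w i ∧ (¬(1 ≤ i ∧ i ≤ (N : ℤ)) → w i = 0)}
  rw [hset]
  refine MeasurableSet.iInter fun i =>
    (measurableSet_le measurable_const (measurable_pi_apply i)).inter ?_
  by_cases h : 1 ≤ i ∧ i ≤ (N : ℤ)
  · simp [h]
  · simpa [h] using measurableSet_eq_fun (measurable_pi_apply i) measurable_const

lemma IsSiloInvariant.measurePreserving (hμ : IsSiloInvariant N νV μ) :
    MeasurePreserving (fun p => siloStep N p.2.1 p.2.2 p.1) (μ.prod (siloDriveLaw N νV)) μ :=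
  ⟨measurable_siloStep, hμ.2.2⟩

lemma integral_profileWeight_siloStep (hνV : IsVLaw νV) {w : ℤ → ℝ} (hw : IsSiloConfig N w) :
    ∫ d, ∑ i ∈ Finset.Icc (1 : ℤ) N, siloProfile N i * siloUpdate w i d ∂siloDriveLaw N νV =
      ∑ i ∈ Finset.Icc (1 : ℤ) N, siloProfile N i + (profileWeight N w - totalWeight N w) := by
  have := hνV.1
  rw [integral_finsetSum _ fun i _ =>
    ((memLp_siloUpdate hνV.memLp w i).integrable one_le_two).const_mul _,
    ← sum_profile_mul_neighbours hw, ← Finset.sum_add_distrib]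
  refine Finset.sum_congr rfl fun i hi => ?_
  rw [Finset.mem_Icc] at hi
  rw [integral_const_mul, integral_siloUpdate hνV.memLp hνV.2.2.1 w hi.1 hi.2]
  ring

lemma profileWeight_sub_le (hN : 1 ≤ N) {w : ℤ → ℝ} (hw : IsSiloConfig N w) :
    profileWeight N w - totalWeight N w ≤ (1 - 1 / (N : ℝ) ^ 2) * profileWeight N w := by
  have hN' : (0 : ℝ) < (N : ℝ) ^ 2 := by positivity
  have := (div_le_iff₀' hN').2 (profileWeight_le hw)
  rw [sub_mul, one_mul, one_div_mul_eq_div]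
  linarith

lemma IsSiloInvariant.integrable_profileWeight (hνV : IsVLaw νV) (hN : 1 ≤ N)
    (hμ : IsSiloInvariant N νV μ) : Integrable (profileWeight N) μ := by
  have := hνV.1
  have := hμ.1
  have hN' : (1 : ℝ) ≤ (N : ℝ) ^ 2 := one_le_pow₀ (by exact_mod_cast hN)
  refine integrable_of_drift hμ.measurePreserving measurable_profileWeight ?_
    (integrable_const (∑ i ∈ Finset.Icc (1 : ℤ) N, siloProfile N i))
    (c := 1 - 1 / (N : ℝ) ^ 2) ?_ ?_ ?_
  · filter_upwards [hμ.ae_isSiloConfig] with w hw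
    exact (totalWeight_nonneg hw).trans (totalWeight_le_profileWeight hw)
  · exact sub_nonneg.2 ((div_le_one (by linarith)).2 hN')
  · have : 0 < 1 / (N : ℝ) ^ 2 := by positivity
    linarith
  filter_upwards [hμ.ae_isSiloConfig] with w hw
  refine ⟨fun d => ∑ i ∈ Finset.Icc (1 : ℤ) N, siloProfile N i * siloUpdate w i d, ?_, ?_, ?_⟩
  · exact integrable_finsetSum _ fun i _ =>
      ((memLp_siloUpdate hνV.memLp w i).integrable one_le_two).const_mul _
  · filter_upwards [siloDriveLaw_ae_bounds hνV] with d hd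
    refine ⟨Finset.sum_nonneg fun i hi => ?_, (profileWeight_siloStep hw d).le⟩
    rw [Finset.mem_Icc] at hi
    exact mul_nonneg (zero_le_one.trans (one_le_siloProfile hi.1 hi.2))
      (siloUpdate_nonneg hw hd.1 hd.2 i)
  · rw [integral_profileWeight_siloStep hνV hw]
    linarith [profileWeight_sub_le hN hw]

/-- Mean of the product of the total weight and the profile weight after one step, with the weight
lost through the boundary added back. -/
lemma integral_weight_mul_profileWeight (hνV : IsVLaw νV) {w : ℤ → ℝ} (hw : IsSiloConfig N w) :
    ∫ d, (totalWeight N d.2 + totalWeight N w) *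
        ∑ i ∈ Finset.Icc (1 : ℤ) N, siloProfile N i * siloUpdate w i d ∂siloDriveLaw N νV =
      (N + totalWeight N w) * (∑ i ∈ Finset.Icc (1 : ℤ) N, siloProfile N i +
        (profileWeight N w - totalWeight N w)) +
      cov[fun x => x, fun x => x; νV] * ∑ i ∈ Finset.Icc (1 : ℤ) N, siloProfile N i := by
  have := hνV.1
  have hm := hνV.memLp
  have hv : ∀ j ∈ Finset.Icc (1 : ℤ) N,
      MemLp (fun d : (ℤ → ℝ) × (ℤ → ℝ) => d.2 j) 2 (siloDriveLaw N νV) :=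
    fun j _ => memLp_grain hm j
  have hu : ∀ i ∈ Finset.Icc (1 : ℤ) N, MemLp
      (fun d : (ℤ → ℝ) × (ℤ → ℝ) => siloProfile N i * siloUpdate w i d) 2 (siloDriveLaw N νV) :=
    fun i _ => (memLp_siloUpdate hm w i).const_mul _
  have hT : MemLp (fun d : (ℤ → ℝ) × (ℤ → ℝ) => totalWeight N d.2) 2 (siloDriveLaw N νV) :=
    memLp_finsetSum _ hv
  have hT' : MemLp (fun d : (ℤ → ℝ) × (ℤ → ℝ) => totalWeight N d.2 + totalWeight N w) 2
    (siloDriveLaw N νV) := hT.add (memLp_const _)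
  have hP : MemLp (fun d : (ℤ → ℝ) × (ℤ → ℝ) => ∑ i ∈ Finset.Icc (1 : ℤ) N,
    siloProfile N i * siloUpdate w i d) 2 (siloDriveLaw N νV) := memLp_finsetSum _ hu
  have hTint : ∫ d, totalWeight N d.2 ∂siloDriveLaw N νV = N := by
    simp only [totalWeight]
    rw [integral_finsetSum _ fun j hj => (hv j hj).integrable one_le_two,
      Finset.sum_congr rfl fun j hj => (integral_grain (Finset.mem_Icc.1 hj).1
        (Finset.mem_Icc.1 hj).2).trans hνV.2.2.1]
    simp
  have hcov : cov[fun d => totalWeight N d.2 + totalWeight N w, fun d =>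
      ∑ i ∈ Finset.Icc (1 : ℤ) N, siloProfile N i * siloUpdate w i d; siloDriveLaw N νV] =
      cov[fun x => x, fun x => x; νV] * ∑ i ∈ Finset.Icc (1 : ℤ) N, siloProfile N i := by
    rw [covariance_add_const_left (hT.integrable one_le_two), covariance_comm]
    simp only [totalWeight]
    rw [covariance_fun_sum_fun_sum' hu hv, Finset.mul_sum]
    refine Finset.sum_congr rfl fun i hi => ?_
    have hi' := Finset.mem_Icc.1 hi
    rw [Finset.sum_congr rfl fun j hj => (covariance_const_mul_left (siloProfile N i)).trans
      (congrArg _ (covariance_siloUpdate_grain hm w hi'.1 hi'.2 (Finset.mem_Icc.1 hj).1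
        (Finset.mem_Icc.1 hj).2)), ← Finset.mul_sum, Finset.sum_ite_eq, if_pos hi, mul_comm]
  have h := covariance_eq_sub hT' hP
  rw [hcov, integral_profileWeight_siloStep hνV hw,
    integral_add (hT.integrable one_le_two) (integrable_const _), hTint] at h
  simp only [Pi.mul_apply, integral_const, probReal_univ, smul_eq_mul, one_mul] at h
  linarith

lemma IsSiloInvariant.integrable_weight_mul_profileWeight (hνV : IsVLaw νV) (hN : 1 ≤ N)
    (hμ : IsSiloInvariant N νV μ) :
    Integrable (fun w => totalWeight N w * profileWeight N w) μ := by
  have := hνV.1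
  have := hμ.1
  have hN' : (1 : ℝ) ≤ (N : ℝ) ^ 2 := one_le_pow₀ (by exact_mod_cast hN)
  set P := ∑ i ∈ Finset.Icc (1 : ℤ) N, siloProfile N i with hP
  have hP0 : 0 ≤ P := Finset.sum_nonneg fun i hi =>
    zero_le_one.trans (one_le_siloProfile (Finset.mem_Icc.1 hi).1 (Finset.mem_Icc.1 hi).2)
  set α := cov[fun x => x, fun x => x; νV] with hα
  refine integrable_of_drift hμ.measurePreserving
    (measurable_totalWeight.mul measurable_profileWeight) ?_
    (((hμ.integrable_profileWeight hνV hN).const_mul (N + P)).add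
      (integrable_const (N * P + α * P)))
    (c := 1 - 1 / (N : ℝ) ^ 2) ?_ ?_ ?_
  · filter_upwards [hμ.ae_isSiloConfig] with w hw
    exact mul_nonneg (totalWeight_nonneg hw)
      ((totalWeight_nonneg hw).trans (totalWeight_le_profileWeight hw))
  · exact sub_nonneg.2 ((div_le_one (by linarith)).2 hN')
  · have : 0 < 1 / (N : ℝ) ^ 2 := by positivity
    linarith
  filter_upwards [hμ.ae_isSiloConfig] with w hw
  have hX := totalWeight_nonneg hw
  have hXY := totalWeight_le_profileWeight hw
  refine ⟨fun d => (totalWeight N d.2 + totalWeight N w) *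
    ∑ i ∈ Finset.Icc (1 : ℤ) N, siloProfile N i * siloUpdate w i d, ?_, ?_, ?_⟩
  · refine MemLp.integrable_mul (p := 2) (q := 2) ?_ ?_
    · exact (memLp_finsetSum _ fun j _ => memLp_grain hνV.memLp j).add (memLp_const _)
    · exact memLp_finsetSum _ fun i _ => (memLp_siloUpdate hνV.memLp w i).const_mul _
  · filter_upwards [siloDriveLaw_ae_bounds hνV] with d hd
    have hY : 0 ≤ ∑ i ∈ Finset.Icc (1 : ℤ) N, siloProfile N i * siloUpdate w i d :=
      Finset.sum_nonneg fun i hi => mul_nonneg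
        (zero_le_one.trans (one_le_siloProfile (Finset.mem_Icc.1 hi).1 (Finset.mem_Icc.1 hi).2))
        (siloUpdate_nonneg hw hd.1 hd.2 i)
    refine ⟨mul_nonneg (add_nonneg (Finset.sum_nonneg fun i _ => hd.2 i) hX) hY, ?_⟩
    show totalWeight N _ * profileWeight N _ ≤ _
    rw [profileWeight_siloStep hw]
    exact mul_le_mul_of_nonneg_right (totalWeight_siloStep_le hw hd.1) hY
  · rw [integral_weight_mul_profileWeight hνV hw, ← hP, ← hα]
    have h1 := mul_le_mul_of_nonneg_left (profileWeight_sub_le hN hw) hX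
    have h2 := mul_le_mul_of_nonneg_right hXY hP0
    have h3 : 0 ≤ (N : ℝ) * totalWeight N w := by positivity
    simp only [Pi.add_apply]
    linarith

lemma IsSiloInvariant.memLp_apply (hνV : IsVLaw νV) (hN : 1 ≤ N)
    (hμ : IsSiloInvariant N νV μ) (i : ℤ) : MemLp (fun w : ℤ → ℝ => w i) 2 μ := by
  refine (memLp_two_iff_integrable_sq (measurable_pi_apply i).aestronglyMeasurable).2
    ((hμ.integrable_weight_mul_profileWeight hνV hN).mono'
      ((measurable_pi_apply i).pow_const 2).aestronglyMeasurable ?_)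
  filter_upwards [hμ.ae_isSiloConfig] with w hw
  have hX := totalWeight_nonneg hw
  have hXY := totalWeight_le_profileWeight hw
  rw [Real.norm_eq_abs, abs_of_nonneg (sq_nonneg _), pow_two]
  by_cases hi : 1 ≤ i ∧ i ≤ (N : ℤ)
  · have := le_totalWeight hw hi.1 hi.2
    exact mul_le_mul this (this.trans hXY) (hw i).1 hX
  · rw [(hw i).2 hi, mul_zero]
    exact mul_nonneg hX (hX.trans hXY)

lemma IsSiloInvariant.integral_eq (hμ : IsSiloInvariant N νV μ) (hν : IsProbabilityMeasure νV)
    {F : (ℤ → ℝ) → ℝ} (hF : Integrable F μ) :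
    ∫ w, F w ∂μ = ∫ w, ∫ d, F (siloStep N d.1 d.2 w) ∂siloDriveLaw N νV ∂μ := by
  have := hμ.1
  have hS := hμ.measurePreserving
  have hFS : Integrable (fun p : (ℤ → ℝ) × (ℤ → ℝ) × (ℤ → ℝ) => F (siloStep N p.2.1 p.2.2 p.1))
      (μ.prod (siloDriveLaw N νV)) := hS.integrable_comp_of_integrable hF
  rw [← integral_prod _ hFS]
  conv_lhs => rw [← hS.map_eq]
  refine integral_map hS.measurable.aemeasurable ?_
  rw [hS.map_eq]
  exact hF.aestronglyMeasurable

lemma IsSiloInvariant.integral_apply_eq_zero (hμ : IsSiloInvariant N νV μ) {i : ℤ}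
    (hi : ¬(1 ≤ i ∧ i ≤ (N : ℤ))) : ∫ w, w i ∂μ = 0 :=
  integral_eq_zero_of_ae (hμ.ae_isSiloConfig.mono fun _ hw => (hw i).2 hi)

lemma IsSiloInvariant.integral_apply (hνV : IsVLaw νV) (hN : 1 ≤ N)
    (hμ : IsSiloInvariant N νV μ) {i : ℤ} (hi0 : 0 ≤ i) (hin : i ≤ N + 1) :
    ∫ w, w i ∂μ = siloProfile N i := by
  have := hνV.1
  have := hμ.1
  have hcoord : ∀ k : ℤ, Integrable (fun w : ℤ → ℝ => w k) μ :=
    fun k => (hμ.memLp_apply hνV hN k).integrable one_le_two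
  refine eq_profile_of_mean_equation N (fun i => ∫ w, w i ∂μ)
    (hμ.integral_apply_eq_zero (by omega)) (hμ.integral_apply_eq_zero (by omega)) ?_ i hi0 hin
  intro k h1 h2
  rw [hμ.integral_eq hνV.1 (hcoord k)]
  calc ∫ w, ∫ d, siloStep N d.1 d.2 w k ∂siloDriveLaw N νV ∂μ
      = ∫ w, (1 + (w (k + 1) + w (k - 1)) / 2) ∂μ := by
        refine integral_congr_ae ?_
        filter_upwards [hμ.ae_isSiloConfig] with w hw
        simp only [siloStep_eq_siloUpdate hw h1 h2]
        exact integral_siloUpdate hνV.memLp hνV.2.2.1 w h1 h2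
    _ = _ := by
        have h : Integrable (fun w : ℤ → ℝ => (w (k + 1) + w (k - 1)) / 2) μ :=
          ((hcoord _).add (hcoord _)).div_const _
        rw [integral_add (integrable_const _) h, integral_div, integral_add (hcoord _) (hcoord _)]
        simp

lemma covariance_const_add_half_add [IsProbabilityMeasure μ]
    {X X' Y Y' : (ℤ → ℝ) → ℝ} (hX : MemLp X 2 μ) (hX' : MemLp X' 2 μ) (hY : MemLp Y 2 μ)
    (hY' : MemLp Y' 2 μ) (c : ℝ) :
    cov[fun w => c + (X w + X' w) / 2, fun w => c + (Y w + Y' w) / 2; μ] =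
      (cov[X, Y; μ] + cov[X, Y'; μ] + cov[X', Y; μ] + cov[X', Y'; μ]) / 4 := by
  have hXX := hX.add hX'
  have hYY := hY.add hY'
  have e : ∀ Z Z' : (ℤ → ℝ) → ℝ, (fun w => c + (Z w + Z' w) / 2) =
      fun w => c + ((2⁻¹ : ℝ) • (Z + Z')) w := by
    intro Z Z'
    ext w
    simp only [Pi.smul_apply, Pi.add_apply, smul_eq_mul]
    ring
  rw [e, e, covariance_const_add_left ((hXX.const_smul _).integrable one_le_two),
    covariance_const_add_right ((hYY.const_smul _).integrable one_le_two), covariance_smul_left,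
    covariance_smul_right, covariance_add_left hX hX' hYY, covariance_add_right hX hY hY',
    covariance_add_right hX' hY hY']
  ring

lemma integral_const_add_div_add [IsProbabilityMeasure μ] {f g : (ℤ → ℝ) → ℝ}
    (hf : Integrable f μ) (hg : Integrable g μ) (c r : ℝ) :
    ∫ w, (c + f w / r + g w) ∂μ = c + (∫ w, f w ∂μ) / r + ∫ w, g w ∂μ := by
  have hr : Integrable (fun w => f w / r) μ := hf.div_const r
  have h : Integrable (fun w => c + f w / r) μ := (integrable_const c).add hr
  rw [integral_add h hg, integral_add (integrable_const c) hr, integral_div]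
  simp

lemma integral_ite_zero (p : Prop) [Decidable p] (f : (ℤ → ℝ) → ℝ) :
    ∫ w, (if p then f w else 0) ∂μ = if p then ∫ w, f w ∂μ else 0 := by
  split_ifs <;> simp

lemma integrable_ite_zero (p : Prop) [Decidable p] {f : (ℤ → ℝ) → ℝ} (hf : Integrable f μ) :
    Integrable (fun w => if p then f w else 0) μ := by
  split_ifs <;> simp [hf]

lemma integrable_drive_covariance (hL2 : ∀ k : ℤ, MemLp (fun w : ℤ → ℝ => w k) 2 μ) (i j : ℤ) :
    Integrable (fun w => (if i = j then w (i + 1) * w (i + 1) + w (i - 1) * w (i - 1) else 0)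
      - (if i + 1 = j - 1 then w (i + 1) * w (i + 1) else 0)
      - (if i - 1 = j + 1 then w (i - 1) * w (i - 1) else 0)) μ :=
  have h2 : ∀ k : ℤ, Integrable (fun w : ℤ → ℝ => w k * w k) μ :=
    fun k => (hL2 k).integrable_mul (hL2 k)
  ((integrable_ite_zero _ ((h2 (i + 1)).add (h2 (i - 1)))).sub
    (integrable_ite_zero _ (h2 (i + 1)))).sub (integrable_ite_zero _ (h2 (i - 1)))

lemma integral_drive_covariance (hL2 : ∀ k : ℤ, MemLp (fun w : ℤ → ℝ => w k) 2 μ) (i j : ℤ) :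
    ∫ w, ((if i = j then w (i + 1) * w (i + 1) + w (i - 1) * w (i - 1) else 0)
      - (if i + 1 = j - 1 then w (i + 1) * w (i + 1) else 0)
      - (if i - 1 = j + 1 then w (i - 1) * w (i - 1) else 0)) ∂μ =
    (if i = j then (∫ w, w (i + 1) * w (i + 1) ∂μ) + ∫ w, w (i - 1) * w (i - 1) ∂μ else 0)
      - (if i + 1 = j - 1 then ∫ w, w (i + 1) * w (i + 1) ∂μ else 0)
      - (if i - 1 = j + 1 then ∫ w, w (i - 1) * w (i - 1) ∂μ else 0) := by
  have h2 : ∀ k : ℤ, Integrable (fun w : ℤ → ℝ => w k * w k) μ :=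
    fun k => (hL2 k).integrable_mul (hL2 k)
  have ha : Integrable (fun w : ℤ → ℝ =>
      if i = j then w (i + 1) * w (i + 1) + w (i - 1) * w (i - 1) else 0) μ :=
    integrable_ite_zero _ ((h2 (i + 1)).add (h2 (i - 1)))
  have hb : Integrable (fun w : ℤ → ℝ => if i + 1 = j - 1 then w (i + 1) * w (i + 1) else 0) μ :=
    integrable_ite_zero _ (h2 (i + 1))
  have hc : Integrable (fun w : ℤ → ℝ => if i - 1 = j + 1 then w (i - 1) * w (i - 1) else 0) μ :=
    integrable_ite_zero _ (h2 (i - 1))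
  have hab : Integrable (fun w : ℤ → ℝ =>
      (if i = j then w (i + 1) * w (i + 1) + w (i - 1) * w (i - 1) else 0) -
        if i + 1 = j - 1 then w (i + 1) * w (i + 1) else 0) μ := ha.sub hb
  rw [integral_sub hab hc, integral_sub ha hb, integral_ite_zero, integral_ite_zero,
    integral_ite_zero, integral_add (h2 _) (h2 _)]

lemma IsSiloInvariant.integral_average (hνV : IsVLaw νV) (hN : 1 ≤ N)
    (hμ : IsSiloInvariant N νV μ) {k : ℤ} (h1 : 1 ≤ k) (h2 : k ≤ N) :
    ∫ w, (1 + (w (k + 1) + w (k - 1)) / 2) ∂μ = ∫ w, w k ∂μ := by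
  have := hνV.1
  have := hμ.1
  rw [hμ.integral_eq hνV.1 ((hμ.memLp_apply hνV hN k).integrable one_le_two)]
  refine integral_congr_ae ?_
  filter_upwards [hμ.ae_isSiloConfig] with w hw
  simp only [siloStep_eq_siloUpdate hw h1 h2]
  exact (integral_siloUpdate hνV.memLp hνV.2.2.1 w h1 h2).symm

lemma IsSiloInvariant.integral_mul_eq (hνV : IsVLaw νV) (hN : 1 ≤ N)
    (hμ : IsSiloInvariant N νV μ) {i j : ℤ} (hi : 1 ≤ i) (hi' : i ≤ N) (hj : 1 ≤ j)
    (hj' : j ≤ N) :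
    ∫ w, w i * w j ∂μ = ∫ w, (((if i = j then cov[fun x => x, fun x => x; νV] else 0) +
        ((if i = j then w (i + 1) * w (i + 1) + w (i - 1) * w (i - 1) else 0)
          - (if i + 1 = j - 1 then w (i + 1) * w (i + 1) else 0)
          - (if i - 1 = j + 1 then w (i - 1) * w (i - 1) else 0)) / 12) +
        (1 + (w (i + 1) + w (i - 1)) / 2) * (1 + (w (j + 1) + w (j - 1)) / 2)) ∂μ := by
  have := hνV.1
  have hm := hνV.memLp
  have hcoord : Integrable (fun w : ℤ → ℝ => w i * w j) μ :=
    (hμ.memLp_apply hνV hN i).integrable_mul (hμ.memLp_apply hνV hN j)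
  rw [hμ.integral_eq hνV.1 hcoord]
  refine integral_congr_ae ?_
  filter_upwards [hμ.ae_isSiloConfig] with w hw
  have h := covariance_eq_sub (memLp_siloUpdate (N := N) hm w i)
    (memLp_siloUpdate (N := N) hm w j)
  rw [covariance_siloUpdate_siloUpdate hm w hi hi' hj hj',
    integral_siloUpdate hm hνV.2.2.1 w hi hi', integral_siloUpdate hm hνV.2.2.1 w hj hj',
    eq_sub_iff_add_eq] at h
  simp only [Pi.mul_apply, siloStep_eq_siloUpdate hw hi hi',
    siloStep_eq_siloUpdate hw hj hj'] at h ⊢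
  exact h.symm

/-- The linear equations for the covariances under the invariant measure. -/
lemma IsSiloInvariant.covariance_eq (hνV : IsVLaw νV) (hN : 1 ≤ N)
    (hμ : IsSiloInvariant N νV μ) {i j : ℤ} (hi : 1 ≤ i) (hi' : i ≤ N) (hj : 1 ≤ j)
    (hj' : j ≤ N) :
    cov[fun w => w i, fun w => w j; μ] =
      (cov[fun w => w (i + 1), fun w => w (j + 1); μ] +
        cov[fun w => w (i + 1), fun w => w (j - 1); μ] +
        cov[fun w => w (i - 1), fun w => w (j + 1); μ] +
        cov[fun w => w (i - 1), fun w => w (j - 1); μ]) / 4 +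
      (if i = j then cov[fun x => x, fun x => x; νV] else 0) +
        ((if i = j then (∫ w, w (i + 1) * w (i + 1) ∂μ) + ∫ w, w (i - 1) * w (i - 1) ∂μ else 0)
          - (if i + 1 = j - 1 then ∫ w, w (i + 1) * w (i + 1) ∂μ else 0)
          - (if i - 1 = j + 1 then ∫ w, w (i - 1) * w (i - 1) ∂μ else 0)) / 12 := by
  have := hμ.1
  have hL2 := hμ.memLp_apply hνV hN
  have hq : ∀ k : ℤ, MemLp (fun w : ℤ → ℝ => 1 + (w (k + 1) + w (k - 1)) / 2) 2 μ := by
    intro k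
    have h : MemLp (fun w : ℤ → ℝ => 2⁻¹ * (w (k + 1) + w (k - 1))) 2 μ :=
      ((hL2 (k + 1)).add (hL2 (k - 1))).const_mul _
    have h' : MemLp (fun w : ℤ → ℝ => 1 + 2⁻¹ * (w (k + 1) + w (k - 1))) 2 μ :=
      (memLp_const (1 : ℝ)).add h
    simpa only [div_eq_inv_mul] using h'
  have hQ : Integrable (fun w : ℤ → ℝ =>
      (1 + (w (i + 1) + w (i - 1)) / 2) * (1 + (w (j + 1) + w (j - 1)) / 2)) μ :=
    (hq i).integrable_mul (hq j)
  have h0 := hμ.integral_mul_eq hνV hN hi hi' hj hj'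
  rw [integral_const_add_div_add (integrable_drive_covariance hL2 i j) hQ,
    integral_drive_covariance hL2] at h0
  have h1 := covariance_eq_sub (hL2 i) (hL2 j)
  have h2 := covariance_eq_sub (hq i) (hq j)
  rw [hμ.integral_average hνV hN hi hi', hμ.integral_average hνV hN hj hj',
    covariance_const_add_half_add (hL2 _) (hL2 _) (hL2 _) (hL2 _)] at h2
  simp only [Pi.mul_apply] at h1 h2
  rw [h1, h0, h2]
  ring

lemma IsSiloInvariant.integral_mul_self_eq (hνV : IsVLaw νV) (hN : 1 ≤ N)
    (hμ : IsSiloInvariant N νV μ) {i : ℤ} (hi0 : 0 ≤ i) (hin : i ≤ N + 1) :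
    ∫ w, w i * w i ∂μ = cov[fun w => w i, fun w => w i; μ] + siloProfile N i ^ 2 := by
  have := hμ.1
  have h := covariance_eq_sub (hμ.memLp_apply hνV hN i) (hμ.memLp_apply hνV hN i)
  simp only [Pi.mul_apply] at h
  rw [hμ.integral_apply hνV hN hi0 hin] at h
  linarith

lemma IsSiloInvariant.covariance_eq_zero (hμ : IsSiloInvariant N νV μ) {i : ℤ}
    (hi : ¬(1 ≤ i ∧ i ≤ (N : ℤ))) (Z : (ℤ → ℝ) → ℝ) : cov[fun w => w i, Z; μ] = 0 := by
  refine integral_eq_zero_of_ae ?_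
  filter_upwards [hμ.ae_isSiloConfig] with w hw
  simp [hμ.integral_apply_eq_zero hi, (hw i).2 hi]

end Invariant

/-- The defect of half the squared profile in the covariance equation on the diagonal. -/
lemma abs_profile_defect_le {N : ℕ} (α : ℝ) (hα : 0 ≤ α) {i : ℤ} (h1 : 1 ≤ i) (h2 : i ≤ N) :
    |α + (siloProfile N (i + 1) ^ 2 + siloProfile N (i - 1) ^ 2) / 4 - siloProfile N i ^ 2 / 2| ≤
      α + (N : ℝ) ^ 2 := by
  have h1' : (1 : ℝ) ≤ i := by exact_mod_cast h1
  have h2' : (i : ℝ) ≤ N := by exact_mod_cast h2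
  have e : α + (siloProfile N (i + 1) ^ 2 + siloProfile N (i - 1) ^ 2) / 4
      - siloProfile N i ^ 2 / 2 = α - siloProfile N i + 1 / 2 + (N + 1 - 2 * i) ^ 2 / 2 := by
    simp only [siloProfile]; push_cast; ring
  have hp := siloProfile_le h1 h2
  have hp' := one_le_siloProfile h1 h2
  have hsq : ((N : ℝ) + 1 - 2 * i) ^ 2 ≤ (N : ℝ) ^ 2 :=
    sq_le_sq' (by linarith) (by linarith)
  have := sq_nonneg ((N : ℝ) + 1 - 2 * i)
  rw [e]
  exact abs_le.2 ⟨by linarith, by linarith [sq_nonneg (N : ℝ)]⟩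

lemma IsSiloInvariant.abs_covariance_sub_le {N : ℕ} {νV : Measure ℝ} {μ : Measure (ℤ → ℝ)}
    (hνV : IsVLaw νV) (hN : 1 ≤ N) (hμ : IsSiloInvariant N νV μ) {i : ℤ} (h1 : 1 ≤ i)
    (h2 : i ≤ N) :
    |cov[fun w => w i, fun w => w i; μ] - siloProfile N i ^ 2 / 2| ≤
      3 / 2 * (cov[fun x => x, fun x => x; νV] + (N : ℝ) ^ 2) * (N + 1) +
        3 / 2 * siloProfile N i := by
  set α := cov[fun x => x, fun x => x; νV] with hα
  have hα0 : 0 ≤ α := integral_nonneg fun x => mul_self_nonneg _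
  have key := abs_diag_le_of_pair_equation (N + 1)
    (fun i j => cov[fun w => w i, fun w => w j; μ] -
      if i = j then siloProfile N i ^ 2 / 2 else 0)
    (fun i => α + (siloProfile N (i + 1) ^ 2 + siloProfile N (i - 1) ^ 2) / 4 -
      siloProfile N i ^ 2 / 2) (α + (N : ℝ) ^ 2) (by positivity) ?_ ?_
    (fun i h0 hn => abs_profile_defect_le α hα0 (by omega) (by omega)) i (by omega) (by omega)
  · simp only [if_true] at key
    push_cast at key
    exact key
  · intro i j hij
    have hcov : cov[fun w => w i, fun w => w j; μ] = 0 := by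
      by_cases hi : 1 ≤ i ∧ i ≤ (N : ℤ)
      · rw [covariance_comm, hμ.covariance_eq_zero (by omega)]
      · exact hμ.covariance_eq_zero hi _
    rw [hcov, zero_sub, neg_eq_zero]
    split_ifs with h
    · have : i = 0 ∨ i = N + 1 := by omega
      rcases this with rfl | rfl <;> simp [siloProfile]
    · rfl
  · intro i j hi hi' hj hj'
    have h := hμ.covariance_eq hνV hN (i := i) (j := j) (by omega) (by omega) (by omega) (by omega)
    rw [hμ.integral_mul_self_eq hνV hN (i := i + 1) (by omega) (by omega),
      hμ.integral_mul_self_eq hνV hN (i := i - 1) (by omega) (by omega), ← hα] at h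
    have e1 : i + 1 = j + 1 ↔ i = j := by omega
    have e2 : i - 1 = j - 1 ↔ i = j := by omega
    rw [h]
    simp only [e1, e2, if_true]
    rcases eq_or_ne i j with hij | hij
    · subst hij
      have n1 : ¬i + 1 = i - 1 := by omega
      have n2 : ¬i - 1 = i + 1 := by omega
      simp only [n1, n2, if_true, if_false]
      ring
    · simp only [hij, if_false]
      rcases eq_or_ne (i + 1) (j - 1) with h' | h'
      · have n2 : ¬i - 1 = j + 1 := by omega
        simp only [h', n2, if_true, if_false]
        ring
      · simp only [h', if_false]
        rcases eq_or_ne (i - 1) (j + 1) with h'' | h''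
        · simp only [h'', if_true]
          ring
        · simp only [h'', if_false]
          ring

/-- The variance at site `i` under the invariant measure of the width-`N` silo differs
from `(w^N(i))² / 2` by at most `C N³`, uniformly in `N`, where `w^N(i) = i (N+1-i)`. -/
theorem silo_variance_bound (νV : Measure ℝ) (hνV : IsVLaw νV) :
    ∃ C : ℝ, 0 < C ∧ ∀ N : ℕ, 1 ≤ N → ∀ μ : Measure (ℤ → ℝ), IsSiloInvariant N νV μ →
      ∀ i : ℤ, 1 ≤ i → i ≤ (N : ℤ) →
        |((∫ w : ℤ → ℝ, w i * w i ∂μ) -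
              ((i : ℝ) * ((N : ℝ) + 1 - (i : ℝ))) ^ 2) -
            ((i : ℝ) * ((N : ℝ) + 1 - (i : ℝ))) ^ 2 / 2| ≤
          C * (N : ℝ) ^ 3 := by
  have hα0 : 0 ≤ cov[fun x => x, fun x => x; νV] := integral_nonneg fun x => mul_self_nonneg _
  set α := cov[fun x => x, fun x => x; νV] with hα
  refine ⟨3 * α + 5, by positivity, fun N hN μ hμ i h1 h2 => ?_⟩
  have key := hμ.abs_covariance_sub_le hνV hN h1 h2
  have hsq := hμ.integral_mul_self_eq hνV hN (i := i) (by omega) (by omega)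
  have hp := siloProfile_le h1 h2
  have hN' : (1 : ℝ) ≤ N := by exact_mod_cast hN
  rw [hsq, show (i : ℝ) * ((N : ℝ) + 1 - (i : ℝ)) = siloProfile N i from rfl, add_sub_cancel_right]
  refine key.trans ?_
  rw [← hα]
  have hN2 : (N : ℝ) ≤ (N : ℝ) ^ 2 := le_self_pow₀ hN' (by norm_num)
  have hN3 : (N : ℝ) ^ 2 ≤ (N : ℝ) ^ 3 := pow_le_pow_right₀ hN' (by norm_num)
  have h3 : α * (N + 1) ≤ α * (2 * (N : ℝ) ^ 3) := mul_le_mul_of_nonneg_left (by linarith) hα0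
  have h4 : (N : ℝ) ^ 2 * (N + 1) = (N : ℝ) ^ 3 + (N : ℝ) ^ 2 := by ring
  linarith
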